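/- Let p be a prime, c ≥ 0, and n = (c+1)·p. Then ((−1)^c + e_{n−1−c}(n)) · (c+1) ≡ 0 (mod n). -/

import Mathlib

/-- `esymm k n` is the sum of the products of all `k`-element subsets of `{1, …, n-1}`. -/
def esymm (k n : ℕ) : ℤ :=
  ∑ S ∈ (Finset.Icc 1 (n - 1)).powersetCard k, ∏ i ∈ S, (i : ℤ)

open Polynomial in
theorem FiniteField.prod_X_add_C_eq_X_pow_card_sub_X (K : Type*) [Field K] [Fintype K] :
    ∏ a : K, (X + C a) = X ^ Fintype.card K - X := by
  have hmonic : (X ^ Fintype.card K - X : K[X]).Monic :=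
    monic_X_pow_sub (by rw [degree_X]; exact_mod_cast Fintype.one_lt_card)
  have hroots := FiniteField.roots_X_pow_card_sub_X K
  have hprod := prod_multiset_X_sub_C_of_monic_of_roots_card_eq hmonic (by
    rw [hroots, FiniteField.X_pow_card_sub_X_natDegree_eq K Fintype.one_lt_card]
    rfl)
  rw [hroots] at hprod
  rw [← hprod, ← Equiv.prod_comp (Equiv.neg K)]
  simp [Finset.prod_map_val, sub_eq_add_neg]

open Polynomial in
theorem ZMod.prod_range_X_add_natCast (p : ℕ) [Fact p.Prime] :
    ∏ i ∈ Finset.range p, (X + C (i : ZMod p)) = X ^ p - X := by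
  have h := FiniteField.prod_X_add_C_eq_X_pow_card_sub_X (ZMod p)
  rw [ZMod.card] at h
  rw [← h]
  refine Finset.prod_bij' (fun i _ => (i : ZMod p)) (fun a _ => a.val) ?_ ?_ ?_ ?_ ?_
  · simp
  · intro a _
    exact Finset.mem_range.2 a.val_lt
  · intro i hi
    exact ZMod.val_cast_of_lt (Finset.mem_range.1 hi)
  · intro a _
    exact ZMod.natCast_zmod_val a
  · simp

open Polynomial in
theorem ZMod.prod_range_mul_X_add_natCast (p m : ℕ) [Fact p.Prime] :
    ∏ i ∈ Finset.range (m * p), (X + C (i : ZMod p)) = (X ^ p - X) ^ m := by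
  induction m with
  | zero => simp
  | succ m ih =>
    rw [add_one_mul, Finset.prod_range_add, ih, pow_succ, ← ZMod.prod_range_X_add_natCast]
    simp

open Polynomial in
theorem ZMod.prod_Icc_X_add_natCast (p c : ℕ) [Fact p.Prime] :
    ∏ i ∈ Finset.Icc 1 ((c + 1) * p - 1), (X + C (i : ZMod p)) =
      X ^ c * (X ^ (p - 1) - 1) ^ (c + 1) := by
  have hp : 0 < p := (Fact.out : p.Prime).pos
  have hn : 0 < (c + 1) * p := by positivity
  have h := ZMod.prod_range_mul_X_add_natCast p (c + 1)
  rw [Finset.range_eq_Ico, Finset.prod_eq_prod_Ico_succ_bot hn, Nat.cast_zero, C_0, add_zero] at h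
  have hIcc : Finset.Icc 1 ((c + 1) * p - 1) = Finset.Ico (0 + 1) ((c + 1) * p) := by
    ext i
    simp only [Finset.mem_Icc, Finset.mem_Ico]
    omega
  apply mul_left_cancel₀ (X_ne_zero (R := ZMod p))
  rw [hIcc, h, ← mul_assoc, ← pow_succ', ← mul_pow, mul_sub, mul_one, mul_pow_sub_one hp.ne']

theorem esymm_cast_zmod (p c : ℕ) [Fact p.Prime] :
    (esymm ((c + 1) * p - 1 - c) ((c + 1) * p) : ZMod p) = (-1) ^ (c + 1) := by
  have hp : 1 < p := (Fact.out : p.Prime).one_lt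
  have hc : c ≤ (Finset.Icc 1 ((c + 1) * p - 1)).card := by
    have : (c + 1) * 1 ≤ (c + 1) * p := Nat.mul_le_mul_left _ hp.le
    simp only [Nat.card_Icc]
    omega
  have h := Finset.prod_X_add_C_coeff (Finset.Icc 1 ((c + 1) * p - 1))
    (fun i : ℕ => (i : ZMod p)) hc
  rw [ZMod.prod_Icc_X_add_natCast, Polynomial.coeff_X_pow_mul', if_pos le_rfl, Nat.sub_self,
    Polynomial.coeff_zero_eq_eval_zero] at h
  simpa [esymm, (Nat.sub_pos_of_lt hp).ne'] using h.symm

theorem stmt_11 (p c n : ℕ) (hp : p.Prime) (hn : n = (c + 1) * p) :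
    ((-1) ^ c + esymm (n - 1 - c) n) * (c + 1) ≡ 0 [ZMOD n] := by
  have := Fact.mk hp
  subst hn
  have h : (p : ℤ) ∣ (-1) ^ c + esymm ((c + 1) * p - 1 - c) ((c + 1) * p) := by
    rw [← ZMod.intCast_zmod_eq_zero_iff_dvd]
    push_cast
    rw [esymm_cast_zmod]
    ring
  rw [Int.modEq_zero_iff_dvd]
  push_cast
  rw [mul_comm ((c : ℤ) + 1)]
  exact mul_dvd_mul_right h _
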